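/- arXiv:1906.05574 — 2 statements merged into one kernel-verified Lean document; each statement's English description precedes it below -/
import Mathlib

section
/- Let k ≥ 1 be a natural number and let p₁, …, p_m (with m ≥ 1) be pairwise distinct natural numbers, each lying in {1, …, k}. Define balances b₀ = 2k and, for 1 ≤ i ≤ m, b_i = b_{i−1} − (2k − p_i) if b_{i−1} ≥ 2k − p_i (the i-th withdrawal succeeds), and b_i = b_{i−1} otherwise (the i-th withdrawal fails). Then: (1) the first withdrawal succeeds; (2) every withdrawal with index i ≥ 2 fails; and (3) the final balance b_m equals p₁. In particular, the final balance uniquely identifies the index p₁ of the single successful withdrawal. -/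
/-- Sequential execution of the consensus algorithm from a `k`-shared
asset-transfer object: the account starts with balance `2k`; the `i`-th
withdrawal (by the pairwise-distinct processes `p 0, p 1, …, p (m-1)`,
each in `{1,…,k}`) withdraws `2k - p i`; it succeeds when the current balance
covers the amount and fails (leaving the balance unchanged) otherwise.
Then the first withdrawal succeeds, all later withdrawals fail, and the final
balance equals `p 0`, the identity of the winning process. -/
theorem one_winner_and_balance_identifies_it
    (k m : ℕ) (hk : 1 ≤ k) (hm : 1 ≤ m)
    (p : Fin m → ℕ)
    (hinj : Function.Injective p)
    (hrange : ∀ i : Fin m, 1 ≤ p i ∧ p i ≤ k)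
    (b : ℕ → ℕ)
    (hb0 : b 0 = 2 * k)
    (hstep : ∀ i : Fin m,
      b ((i : ℕ) + 1) =
        if 2 * k - p i ≤ b (i : ℕ) then b (i : ℕ) - (2 * k - p i) else b (i : ℕ)) :
    (2 * k - p ⟨0, hm⟩ ≤ b 0) ∧
    (∀ i : Fin m, 1 ≤ (i : ℕ) → b (i : ℕ) < 2 * k - p i) ∧
    b m = p ⟨0, hm⟩ := by
  have hfail : ∀ i : Fin m, 1 ≤ (i : ℕ) → p ⟨0, hm⟩ < 2 * k - p i := by
    intro i hi
    have hne : p ⟨0, hm⟩ ≠ p i := fun h => by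
      have h0 : 0 = (i : ℕ) := congrArg Fin.val (hinj h)
      omega
    have h0 := hrange ⟨0, hm⟩
    have h1 := hrange i
    omega
  have hbal : ∀ n, n + 1 ≤ m → b (n + 1) = p ⟨0, hm⟩ := by
    intro n
    induction n with
    | zero =>
      intro _
      have h : b (0 + 1) = if 2 * k - p ⟨0, hm⟩ ≤ b 0 then b 0 - (2 * k - p ⟨0, hm⟩) else b 0 :=
        hstep ⟨0, hm⟩
      have h0 := hrange ⟨0, hm⟩
      rw [h, hb0, if_pos (by omega)]
      omega
    | succ n ih =>
      intro hn
      have h := hstep ⟨n + 1, hn⟩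
      have hlt := hfail ⟨n + 1, hn⟩ (Nat.le_add_left 1 n)
      simp only [ih (by omega)] at h
      rw [h, if_neg (by omega)]
  refine ⟨by omega, fun i hi => ?_, ?_⟩
  · have h := hbal (i - 1) (by omega)
    rw [Nat.sub_add_cancel hi] at h
    rw [h]
    exact hfail i hi
  · have h := hbal (m - 1) (by omega)
    rwa [Nat.sub_add_cancel hm] at h
end

section
/- Let A be a set of accounts, let q₀ : A → ℤ satisfy q₀(a) ≥ 0 for all a, and let t₁, …, t_n be a finite sequence of transfers, where t_i = (a_i, b_i, x_i) with x_i ≥ 0 and a_i ≠ b_i. For a set of indices D ⊆ {1, …, n} and an account a, define bal(a, D) = q₀(a) + ∑_{j ∈ D, b_j = a} x_j − ∑_{j ∈ D, a_j = a} x_j. Suppose that for every i ∈ {1, …, n} there exists a set D_i ⊆ {1, …, i−1} that contains every index j < i with a_j = a_i, and such that bal(a_i, D_i) ≥ x_i. Then for every i, bal(a_i, {1, …, i−1}) ≥ x_i, and for every i ∈ {0, …, n} and every account a, bal(a, {1, …, i}) ≥ 0. -/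
open Finset

/-- Balance of account `a` after applying the transfers with indices in `D`:
the initial balance plus incoming amounts minus outgoing amounts. -/
def bal {A : Type*} [DecidableEq A] {n : ℕ} (q₀ : A → ℤ)
    (src dst : Fin n → A) (amt : Fin n → ℤ) (a : A) (D : Finset (Fin n)) : ℤ :=
  q₀ a + ∑ j ∈ D.filter (fun j => dst j = a), amt j
       - ∑ j ∈ D.filter (fun j => src j = a), amt j

theorem bal_le_bal_of_subset {A : Type*} [DecidableEq A] {n : ℕ} (q₀ : A → ℤ)
    (src dst : Fin n → A) {amt : Fin n → ℤ} (hamt : ∀ i, 0 ≤ amt i) {a : A}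
    {D E : Finset (Fin n)} (hDE : D ⊆ E) (hout : ∀ j ∈ E, src j = a → j ∈ D) :
    bal q₀ src dst amt a D ≤ bal q₀ src dst amt a E := by
  have hsrc : D.filter (fun j => src j = a) = E.filter (fun j => src j = a) := by
    ext j
    simp only [mem_filter]
    exact ⟨fun h => ⟨hDE h.1, h.2⟩, fun h => ⟨hout j h.1 h.2, h.2⟩⟩
  have hdst : ∑ j ∈ D.filter (fun j => dst j = a), amt j
      ≤ ∑ j ∈ E.filter (fun j => dst j = a), amt j :=
    sum_le_sum_of_subset_of_nonneg (filter_subset_filter _ hDE) fun j _ _ => hamt j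
  unfold bal
  rw [hsrc]
  linarith

theorem bal_insert {A : Type*} [DecidableEq A] {n : ℕ} (q₀ : A → ℤ)
    (src dst : Fin n → A) (amt : Fin n → ℤ) (a : A) {k : Fin n}
    {D : Finset (Fin n)} (hk : k ∉ D) :
    bal q₀ src dst amt a (insert k D) = bal q₀ src dst amt a D
      + (if dst k = a then amt k else 0) - (if src k = a then amt k else 0) := by
  simp only [bal, sum_filter, sum_insert hk]
  ring

/-- If every transfer `t_i = (a_i, b_i, x_i)` is validated against a snapshot
`D_i ⊆ {1,…,i-1}` that contains all earlier outgoing transfers from `a_i`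
(but possibly only a subset of the incoming ones), then every transfer is also
backed by sufficient balance with respect to the full prefix `{1,…,i-1}`, and
all account balances after every prefix are nonnegative. -/
theorem snapshot_validation_implies_legal_history
    {A : Type*} [DecidableEq A] (n : ℕ) (q₀ : A → ℤ)
    (src dst : Fin n → A) (amt : Fin n → ℤ)
    (hq₀ : ∀ a, 0 ≤ q₀ a)
    (hamt : ∀ i, 0 ≤ amt i)
    (hne : ∀ i, src i ≠ dst i)
    (hvalid : ∀ i : Fin n, ∃ D : Finset (Fin n),
      (∀ j ∈ D, (j : ℕ) < (i : ℕ)) ∧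
      (∀ j : Fin n, (j : ℕ) < (i : ℕ) → src j = src i → j ∈ D) ∧
      amt i ≤ bal q₀ src dst amt (src i) D) :
    (∀ i : Fin n,
      amt i ≤ bal q₀ src dst amt (src i)
        (Finset.univ.filter (fun j : Fin n => (j : ℕ) < (i : ℕ)))) ∧
    (∀ i : ℕ, i ≤ n → ∀ a : A,
      0 ≤ bal q₀ src dst amt a
        (Finset.univ.filter (fun j : Fin n => (j : ℕ) < i))) := by
  have hprefix : ∀ i : Fin n, amt i ≤ bal q₀ src dst amt (src i)
      (Finset.univ.filter (fun j : Fin n => (j : ℕ) < (i : ℕ))) := by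
    intro i
    obtain ⟨D, hD, hout, hle⟩ := hvalid i
    refine hle.trans (bal_le_bal_of_subset q₀ src dst hamt ?_ ?_)
    · intro j hj
      simpa using hD j hj
    · intro j hj
      exact hout j (by simpa using hj)
  refine ⟨hprefix, fun i => ?_⟩
  induction i with
  | zero => simpa [bal] using hq₀
  | succ i ih =>
    intro hi a
    have hstep : Finset.univ.filter (fun j : Fin n => (j : ℕ) < i + 1)
        = insert ⟨i, hi⟩ (Finset.univ.filter (fun j : Fin n => (j : ℕ) < i)) := by
      ext j
      simp only [mem_filter, mem_univ, true_and, mem_insert, Fin.ext_iff]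
      omega
    rw [hstep, bal_insert _ _ _ _ _ (by simp)]
    have hbal := ih (Nat.le_of_succ_le hi) a
    have hback := hprefix ⟨i, hi⟩
    have hnonneg := hamt ⟨i, hi⟩
    by_cases hsrc : src ⟨i, hi⟩ = a
    · rw [hsrc] at hback
      split_ifs <;> simp_all
    · rw [if_neg hsrc]
      split_ifs <;> omega
end
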